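/- There is an injective group homomorphism φ from the additive group of the 2-adic integers ℤ₂ to the group of units of the formal power series ring 𝔽₂[[X]], uniquely determined by φ(∑_{k ∈ S} 2^k) = F_S for every subset S ⊆ ℕ; in particular every F_S is a unit of 𝔽₂[[X]], the image of φ is exactly {F_S : S ⊆ ℕ}, and φ(n) = (1 + X)^n for every natural number n. (This realizes, at the level of power series, the group isomorphism of Theorem 3.3 between the set of twistings of mod-2 Morava K-theory by K(ℤ, n+2) and the 2-adic integers, with the universal twisting corresponding to the topological generator 1 + X.) -/

import Mathlib

noncomputable section

/-- `B n` is the set of binary digit positions of `n`, i.e. the unique finite set of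
non-negative integers with `n = ∑_{k ∈ B n} 2^k`. -/
def B (n : ℕ) : Finset ℕ := (Finset.range (n + 1)).filter fun k => n.testBit k

open Classical in
/-- `F S ∈ 𝔽₂[[X]]` has coefficient of `X^n` equal to `1` if `B(n) ⊆ S` and `0` otherwise;
for finite `S` one has `F S = ∏_{k ∈ S} (1 + X^{2^k})`. -/
def F (S : Set ℕ) : PowerSeries (ZMod 2) :=
  PowerSeries.mk fun n => if (↑(B n) : Set ℕ) ⊆ S then 1 else 0

open PowerSeries in
/-- `x ↦ (1 + X) ^ x`, from the `2`-adic integers to the units of `𝔽₂[[X]]`. -/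
def onePlusXPow : Multiplicative ℤ_[2] →* (PowerSeries (ZMod 2))ˣ :=
  MonoidHom.toHomUnits
    { toFun := fun x => map (PadicInt.toZMod (p := 2)) (binomialSeries ℤ_[2] x.toAdd)
      map_one' := by simp
      map_mul' := fun x y => by simp }

open PowerSeries in
theorem coe_onePlusXPow (x : ℤ_[2]) :
    (onePlusXPow (Multiplicative.ofAdd x) : PowerSeries (ZMod 2)) =
      map (PadicInt.toZMod (p := 2)) (binomialSeries ℤ_[2] x) := rfl

theorem coe_onePlusXPow_natCast (n : ℕ) :
    (onePlusXPow (Multiplicative.ofAdd (n : ℤ_[2])) : PowerSeries (ZMod 2)) =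
      (1 + PowerSeries.X) ^ n := by
  simp [coe_onePlusXPow]

/-- The coefficient of `X ^ n` in `(1 + X) ^ x` only depends on `x` modulo `2 ^ m`, for
`n < 2 ^ m`. -/
theorem coeff_onePlusXPow_add_two_pow_mul (x y : ℤ_[2]) {m n : ℕ} (h : n < 2 ^ m) :
    PowerSeries.coeff n
        (onePlusXPow (Multiplicative.ofAdd (x + 2 ^ m * y)) : PowerSeries (ZMod 2)) =
      PowerSeries.coeff n (onePlusXPow (Multiplicative.ofAdd x) : PowerSeries (ZMod 2)) := by
  have hy : (2 : ℤ_[2]) ^ m * y = (2 ^ m) • y := by simp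
  rw [hy, ofAdd_add, ofAdd_nsmul, map_mul, map_pow, Units.val_mul, Units.val_pow_eq_pow_val]
  obtain ⟨g, hg⟩ : (PowerSeries.X : PowerSeries (ZMod 2)) ∣
      (onePlusXPow (Multiplicative.ofAdd y) : PowerSeries (ZMod 2)) - 1 := by
    rw [PowerSeries.X_dvd_iff, coe_onePlusXPow, map_sub, ← PowerSeries.coeff_zero_eq_constantCoeff]
    simp
  have : CharP (PowerSeries (ZMod 2)) 2 :=
    charP_of_injective_ringHom (PowerSeries.C_injective (R := ZMod 2)) 2
  rw [sub_eq_iff_eq_add'.mp hg, add_pow_char_pow, one_pow, mul_pow, mul_add, mul_one, map_add,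
    mul_left_comm, PowerSeries.coeff_X_pow_mul', if_neg (by omega), add_zero]

theorem mem_B {n k : ℕ} : k ∈ B n ↔ n.testBit k := by
  simp only [B, Finset.mem_filter, Finset.mem_range, and_iff_right_iff_imp]
  intro h
  have := Nat.ge_two_pow_of_testBit h
  have := k.lt_two_pow_self
  omega

theorem B_two_pow (k : ℕ) : B (2 ^ k) = {k} := by
  ext i
  simp [mem_B, Nat.testBit_two_pow, eq_comm]

/-- A binomial coefficient is odd exactly when the binary digits of the lower argument are among
those of the upper one. -/
theorem choose_cast_zmod_two (N n : ℕ) :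
    ((N.choose n : ℕ) : ZMod 2) = if B n ⊆ B N then 1 else 0 := by
  have : Fact (Nat.Prime 2) := ⟨Nat.prime_two⟩
  have hN : N < 2 ^ (N + n) := Nat.lt_two_pow_self.trans_le (Nat.pow_le_pow_right two_pos (by omega))
  have hn : n < 2 ^ (N + n) := Nat.lt_two_pow_self.trans_le (Nat.pow_le_pow_right two_pos (by omega))
  rw [(ZMod.natCast_eq_natCast_iff _ _ _).mpr (Choose.choose_modEq_prod_range_choose_nat hN hn)]
  have key (i : ℕ) : (N / 2 ^ i % 2).choose (n / 2 ^ i % 2) =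
      if n.testBit i → N.testBit i then 1 else 0 := by
    simp only [Nat.testBit_eq_decide_div_mod_eq, decide_eq_true_eq]
    rcases Nat.mod_two_eq_zero_or_one (N / 2 ^ i) with h | h <;>
    rcases Nat.mod_two_eq_zero_or_one (n / 2 ^ i) with h' | h' <;> simp [h, h']
  simp_rw [key]
  split_ifs with h
  · rw [Finset.prod_eq_one]
    · simp
    · intro i _
      rw [if_pos]
      simpa [mem_B] using @h i
  · obtain ⟨i, hi, hi'⟩ := Finset.not_subset.mp h
    rw [Finset.prod_eq_zero (i := i)]
    · simp
    · have := Nat.ge_two_pow_of_testBit (mem_B.mp hi)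
      have := i.lt_two_pow_self
      simp only [Finset.mem_range]
      omega
    · rw [mem_B] at hi hi'
      simp [hi, hi']

open Classical in
/-- The natural number whose binary digit positions are the elements of `S` below `m`. -/
def digitSum (S : Set ℕ) (m : ℕ) : ℕ := ∑ k ∈ (Finset.range m).filter (· ∈ S), 2 ^ k

theorem mem_B_digitSum {S : Set ℕ} {m k : ℕ} : k ∈ B (digitSum S m) ↔ k < m ∧ k ∈ S := by
  classical
  rw [mem_B, ← Nat.mem_bitIndices, ← List.mem_toFinset, digitSum,
    Finset.toFinset_bitIndices_sum_two_pow]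
  simp

theorem summable_indicator_two_pow (S : Set ℕ) :
    Summable (S.indicator fun k => (2 : ℤ_[2]) ^ k) := by
  refine Summable.of_norm_bounded (g := fun k : ℕ => (2⁻¹ : ℝ) ^ k)
    (summable_geometric_of_lt_one (by norm_num) (by norm_num)) fun k => ?_
  refine (norm_indicator_le_norm_self _ k).trans ?_
  have := PadicInt.norm_p (p := 2)
  push_cast at this
  simp [this]

theorem exists_tsum_two_pow_eq_digitSum_add (S : Set ℕ) (m : ℕ) :
    ∃ y : ℤ_[2], ∑' k : S, (2 : ℤ_[2]) ^ (k : ℕ) = digitSum S m + 2 ^ m * y := by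
  classical
  have hs := summable_indicator_two_pow {i | i + m ∈ S}
  refine ⟨∑' i, Set.indicator {i | i + m ∈ S} (fun k => (2 : ℤ_[2]) ^ k) i, ?_⟩
  rw [tsum_subtype S (fun k => (2 : ℤ_[2]) ^ k), ← hs.tsum_mul_left,
    ← (summable_indicator_two_pow S).sum_add_tsum_nat_add m, digitSum]
  congr 1
  · simp [Finset.sum_filter, Set.indicator_apply]
  · refine tsum_congr fun i => ?_
    simp [Set.indicator_apply, pow_add, mul_comm]

theorem coe_onePlusXPow_tsum (S : Set ℕ) :
    (onePlusXPow (Multiplicative.ofAdd (∑' k : S, (2 : ℤ_[2]) ^ (k : ℕ))) :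
      PowerSeries (ZMod 2)) = F S := by
  classical
  ext n
  obtain ⟨y, hy⟩ := exists_tsum_two_pow_eq_digitSum_add S (n + 1)
  have hn : n < 2 ^ (n + 1) := n.lt_succ_self.trans Nat.lt_two_pow_self
  rw [hy, coeff_onePlusXPow_add_two_pow_mul _ _ hn, coe_onePlusXPow]
  simp only [PowerSeries.coeff_map, PowerSeries.binomialSeries_coeff, Ring.choose_natCast, F,
    PowerSeries.coeff_mk, smul_eq_mul, mul_one, map_natCast, choose_cast_zmod_two]
  refine if_congr ⟨fun h k hk => (mem_B_digitSum.mp (h hk)).2,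
    fun h k hk => mem_B_digitSum.mpr ⟨?_, h hk⟩⟩ rfl rfl
  exact Finset.mem_range.mp (Finset.mem_filter.mp hk).1

theorem exists_tsum_two_pow_eq (x : ℤ_[2]) : ∃ S : Set ℕ, ∑' k : S, (2 : ℤ_[2]) ^ (k : ℕ) = x := by
  classical
  let S : Set ℕ := {k | (x.appr (k + 1)).testBit k}
  have happr (m : ℕ) : digitSum S m = x.appr m := by
    induction m with
    | zero => simp [digitSum, PadicInt.appr]
    | succ m ih =>
      have hlt := x.appr_lt (m + 1)
      have hlt' := x.appr_lt m
      have hle := x.appr_mono m.le_succ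
      obtain ⟨q, hq⟩ := x.dvd_appr_sub_appr m (m + 1) m.le_succ
      have hq' : x.appr (m + 1) = x.appr m + 2 ^ m * q := by
        simp only [Nat.succ_eq_add_one] at hle
        omega
      have hstep : digitSum S (m + 1) = digitSum S m + if m ∈ S then 2 ^ m else 0 := by
        simp [digitSum, Finset.sum_filter, Finset.sum_range_succ]
      have hq2 : q < 2 := by
        by_contra! h
        have := Nat.mul_le_mul_left (2 ^ m) h
        rw [pow_succ] at hlt
        omega
      have hmem : m ∈ S ↔ q = 1 := by
        simp only [S, Set.mem_ofPred_eq, Nat.testBit_eq_decide_div_mod_eq, decide_eq_true_eq, hq',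
          Nat.add_mul_div_left _ _ (Nat.two_pow_pos m), Nat.div_eq_of_lt hlt']
        omega
      rw [hstep, ih, if_congr hmem rfl rfl, hq']
      interval_cases q <;> simp
  refine ⟨S, PadicInt.ext_of_toZModPow.mp fun m => ?_⟩
  obtain ⟨y, hy⟩ := exists_tsum_two_pow_eq_digitSum_add S m
  rw [← sub_eq_zero, ← map_sub, ← RingHom.mem_ker, PadicInt.ker_toZModPow, hy, happr,
    ← neg_mem_iff]
  have := sub_mem (PadicInt.appr_spec m x)
    (Ideal.mul_mem_right y _ (Ideal.mem_span_singleton_self (((2 : ℕ) : ℤ_[2]) ^ m)))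
  convert this using 1
  push_cast
  ring

theorem coeff_F_eq_one_iff {S : Set ℕ} {n : ℕ} :
    PowerSeries.coeff n (F S) = 1 ↔ (↑(B n) : Set ℕ) ⊆ S := by
  simp [F]

theorem F_injective : Function.Injective F := by
  intro S T h
  ext k
  have hk (U : Set ℕ) : k ∈ U ↔ PowerSeries.coeff (2 ^ k) (F U) = 1 := by
    rw [coeff_F_eq_one_iff, B_two_pow, Finset.coe_singleton, Set.singleton_subset_iff]
  rw [hk, hk, h]

/-- There is an injective group homomorphism `φ` from the additive group `ℤ₂` to the units of
`𝔽₂[[X]]`, uniquely determined by `φ(∑_{k ∈ S} 2^k) = F_S` for all `S ⊆ ℕ`; every `F_S` is a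
unit, the image of `φ` is `{F_S : S ⊆ ℕ}`, and `φ(n) = (1 + X)^n` for every natural `n`. -/
theorem exists_padic_to_powerSeries_units :
    ∃ φ : Multiplicative ℤ_[2] →* (PowerSeries (ZMod 2))ˣ,
      Function.Injective φ ∧
      (∀ S : Set ℕ,
        ((φ (Multiplicative.ofAdd (∑' k : S, (2 : ℤ_[2]) ^ (k : ℕ))) : (PowerSeries (ZMod 2))ˣ) :
          PowerSeries (ZMod 2)) = F S) ∧
      (∀ ψ : Multiplicative ℤ_[2] →* (PowerSeries (ZMod 2))ˣ,
        (∀ S : Set ℕ,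
          ((ψ (Multiplicative.ofAdd (∑' k : S, (2 : ℤ_[2]) ^ (k : ℕ))) :
              (PowerSeries (ZMod 2))ˣ) : PowerSeries (ZMod 2)) = F S) → ψ = φ) ∧
      (∀ S : Set ℕ, IsUnit (F S)) ∧
      (Set.range (fun x : Multiplicative ℤ_[2] =>
          ((φ x : (PowerSeries (ZMod 2))ˣ) : PowerSeries (ZMod 2))) =
        {f : PowerSeries (ZMod 2) | ∃ S : Set ℕ, f = F S}) ∧
      (∀ n : ℕ,
        ((φ (Multiplicative.ofAdd ((n : ℤ_[2]))) : (PowerSeries (ZMod 2))ˣ) :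
          PowerSeries (ZMod 2)) = (1 + PowerSeries.X) ^ n) := by
  refine ⟨onePlusXPow, ?_, coe_onePlusXPow_tsum, ?_, ?_, ?_, coe_onePlusXPow_natCast⟩
  · intro x y h
    obtain ⟨S, hS⟩ := exists_tsum_two_pow_eq x.toAdd
    obtain ⟨T, hT⟩ := exists_tsum_two_pow_eq y.toAdd
    have hx := coe_onePlusXPow_tsum S
    have hy := coe_onePlusXPow_tsum T
    rw [hS, ofAdd_toAdd, h] at hx
    rw [hT, ofAdd_toAdd, hx] at hy
    rw [F_injective hy] at hS
    exact Multiplicative.toAdd.injective (hS.symm.trans hT)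
  · intro ψ hψ
    refine MonoidHom.ext fun x => Units.ext ?_
    obtain ⟨S, hS⟩ := exists_tsum_two_pow_eq x.toAdd
    rw [← ofAdd_toAdd x, ← hS, hψ, coe_onePlusXPow_tsum]
  · intro S
    rw [← coe_onePlusXPow_tsum]
    exact Units.isUnit _
  · ext f
    constructor
    · rintro ⟨x, rfl⟩
      obtain ⟨S, hS⟩ := exists_tsum_two_pow_eq x.toAdd
      exact ⟨S, by rw [← coe_onePlusXPow_tsum, hS, ofAdd_toAdd]⟩
    · rintro ⟨S, rfl⟩
      exact ⟨_, coe_onePlusXPow_tsum S⟩
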